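/- arXiv:2503.19778 — 2 statements merged into one kernel-verified Lean document; each statement's English description precedes it below -/
import Mathlib

section
/- Let G1 and G2 be finite groups with G1 abelian. Then the independence complexes Σ(G1) and Σ(G2) are isomorphic if and only if there exists an index-preserving isomorphism between the subgroup lattices of G1 and G2. -/
/-- A subset `X` of a group is independent if no element of `X` lies in the
subgroup generated by the other elements of `X`. -/
def Independent {G : Type*} [Group G] (X : Set G) : Prop :=
  ∀ x ∈ X, x ∉ Subgroup.closure (X \ {x})

/-- `dgen H` is the least cardinality of a generating set of the subgroup `H`. -/
noncomputable def dgen {G : Type*} [Group G] (H : Subgroup G) : ℕ :=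
  sInf {n : ℕ | ∃ S : Set G, S.Finite ∧ S ⊆ (H : Set G) ∧ Subgroup.closure S = H ∧ S.ncard = n}

/-- A subset `X` of a group is strongly independent if every subgroup `H` containing `X`
satisfies `|X| ≤ d(H)`. -/
def StronglyIndependent {G : Type*} [Group G] (X : Set G) : Prop :=
  ∀ H : Subgroup G, X ⊆ (H : Set G) → X.ncard ≤ dgen H

/-- A group is hamiltonian if it is nonabelian and all of its subgroups are normal. -/
def IsHamiltonian (G : Type*) [Group G] : Prop :=
  (∃ a b : G, a * b ≠ b * a) ∧ ∀ H : Subgroup G, H.Normal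

open Subgroup in
theorem mem_zpowers_of_orderOf_dvd {G : Type*} [Group G] [Finite G] {g u v : G}
    (hu : u ∈ zpowers g) (hv : v ∈ zpowers g) (h : orderOf u ∣ orderOf v) : u ∈ zpowers v := by
  classical
  have := Fintype.ofFinite G
  obtain ⟨a, rfl⟩ := mem_zpowers_iff.1 hu
  obtain ⟨b, rfl⟩ := mem_zpowers_iff.1 hv
  set s : zpowers g := ⟨g ^ a, hu⟩
  set t : zpowers g := ⟨g ^ b, hv⟩
  have hst : orderOf s ∣ orderOf t := by
    rw [← Subgroup.orderOf_coe, ← Subgroup.orderOf_coe]; exact h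
  have key : ∀ x : zpowers g, x ^ orderOf t = 1 → x ∈ zpowers t := by
    intro x hx
    have h1 := IsCyclic.card_pow_eq_one_le (α := zpowers g) (orderOf_pos t)
    have hsub : (zpowers t : Set (zpowers g)).toFinset ⊆
        (Finset.univ.filter fun y : zpowers g => y ^ orderOf t = 1) := by
      intro y hy
      simp only [Set.mem_toFinset, SetLike.mem_coe] at hy
      simp only [Finset.mem_filter, Finset.mem_univ, true_and]
      exact orderOf_dvd_iff_pow_eq_one.1 (orderOf_dvd_of_mem_zpowers hy)
    have hcard : (zpowers t : Set (zpowers g)).toFinset.card = orderOf t := by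
      rw [Set.toFinset_card, ← Fintype.card_zpowers]
      rfl
    have heq := Finset.eq_of_subset_of_card_le hsub (by rw [hcard]; exact h1)
    have : x ∈ (zpowers t : Set (zpowers g)).toFinset := by rw [heq]; simpa using hx
    simpa using this
  obtain ⟨k, hk⟩ := mem_zpowers_iff.1 (key s (orderOf_dvd_iff_pow_eq_one.1 hst))
  exact mem_zpowers_iff.2 ⟨k, by simpa using congrArg Subtype.val hk⟩

theorem zpowers_eq_of_mem_of_orderOf_eq {G : Type*} [Group G] [Finite G] {u v : G}
    (hu : u ∈ Subgroup.zpowers v) (h : orderOf u = orderOf v) :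
    Subgroup.zpowers u = Subgroup.zpowers v :=
  le_antisymm (Subgroup.zpowers_le.2 hu) (Subgroup.zpowers_le.2
    (mem_zpowers_of_orderOf_dvd (Subgroup.mem_zpowers v) hu h.symm.dvd))

theorem card_zpowers_eq_zpowers {G : Type*} [Group G] [Finite G] (x : G) :
    Nat.card {y : G // Subgroup.zpowers y = Subgroup.zpowers x} = (orderOf x).totient := by
  classical
  have := Fintype.ofFinite G
  have h := IsCyclic.card_orderOf_eq_totient (α := Subgroup.zpowers x) (d := orderOf x)
    (by rw [Fintype.card_zpowers])
  rw [← h, ← Fintype.card_subtype, ← Nat.card_eq_fintype_card]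
  refine Nat.card_congr
    { toFun := fun y => ⟨⟨y, y.2.le (Subgroup.mem_zpowers y.1)⟩, ?_⟩
      invFun := fun y => ⟨y.1.1, ?_⟩
      left_inv := fun y => rfl
      right_inv := fun y => rfl }
  · rw [Subgroup.orderOf_mk, ← Nat.card_zpowers, y.2, Nat.card_zpowers]
  · have := y.2
    rw [← Subgroup.orderOf_coe] at this
    exact zpowers_eq_of_mem_of_orderOf_eq y.1.2 this

theorem exists_equiv_comp_eq {A B I : Type*} [Finite A] [Finite B] (f : A → I) (g : B → I)
    (h : ∀ i, Nat.card {a // f a = i} = Nat.card {b // g b = i}) :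
    ∃ e : A ≃ B, ∀ a, g (e a) = f a := by
  have key : ∀ i, Nonempty ({a // f a = i} ≃ {b // g b = i}) := fun i =>
    Finite.card_eq.1 (h i)
  have k := fun i => (key i).some
  refine ⟨(Equiv.sigmaFiberEquiv f).symm.trans
    ((Equiv.sigmaCongrRight k).trans (Equiv.sigmaFiberEquiv g)), fun a => ?_⟩
  exact (k (f a) ⟨a, rfl⟩).2

theorem card_eq_sum_card_generators {A : Type*} [Group A] [Finite A] [Fintype (Subgroup A)]
    [DecidableLE (Subgroup A)] (L : Subgroup A) :
    Nat.card L =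
      ∑ M ∈ Finset.univ.filter (· ≤ L), Nat.card {x : A // Subgroup.zpowers x = M} := by
  classical
  have := Fintype.ofFinite A
  have h1 : Nat.card L = (Finset.univ.filter fun x : A => x ∈ L).card := by
    rw [Nat.card_eq_fintype_card, ← Fintype.card_subtype]
  rw [h1, Finset.card_eq_sum_card_fiberwise (f := Subgroup.zpowers)
    (t := Finset.univ.filter (· ≤ L))]
  · refine Finset.sum_congr rfl fun M hM => ?_
    rw [Nat.card_eq_fintype_card, Fintype.card_subtype, Finset.filter_filter]
    congr 1
    ext x
    simp only [Finset.mem_filter, Finset.mem_univ, true_and] at hM ⊢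
    exact ⟨fun h => h.2, fun h => ⟨hM (h ▸ Subgroup.mem_zpowers x), h⟩⟩
  · intro x hx
    simpa using hx

/-- Counting the elements that generate a given subgroup is determined by the orders of its
subgroups. -/
theorem card_generators_eq {G H : Type*} [Group G] [Finite G] [Group H] [Finite H]
    (α : Subgroup G ≃o Subgroup H) (hα : ∀ K, Nat.card (α K) = Nat.card K) (K : Subgroup G) :
    Nat.card {x : G // Subgroup.zpowers x = K} =
      Nat.card {y : H // Subgroup.zpowers y = α K} := by
  classical
  induction K using WellFoundedLT.induction with
  | _ K ih =>
  have := Fintype.ofFinite (Subgroup G)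
  have := Fintype.ofFinite (Subgroup H)
  have h1 := card_eq_sum_card_generators K
  have h2 := card_eq_sum_card_generators (α K)
  have h3 : (∑ M ∈ Finset.univ.filter (· ≤ α K), Nat.card {x : H // Subgroup.zpowers x = M}) =
      ∑ M ∈ Finset.univ.filter (· ≤ K), Nat.card {x : H // Subgroup.zpowers x = α M} :=
    (Finset.sum_bij (fun M _ => α M) (by simp) (by simp)
      (fun M hM => ⟨α.symm M, by simpa [OrderIso.symm_apply_le] using hM, by simp⟩)
      (fun _ _ => rfl)).symm
  have hK : K ∈ Finset.univ.filter (· ≤ K) := by simp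
  rw [h3, hα, h1, ← Finset.add_sum_erase _ _ hK, ← Finset.add_sum_erase _ _ hK,
    Finset.sum_congr rfl (g := fun M => Nat.card {x : H // Subgroup.zpowers x = α M})] at h2
  · exact Nat.add_right_cancel h2
  · intro M hM
    simp only [Finset.mem_erase, Finset.mem_filter, Finset.mem_univ, true_and] at hM
    exact ih M (lt_of_le_of_ne hM.2 hM.1)

theorem independent_image_iff {G H : Type*} [Group G] [Group H] (φ : G ≃ H)
    (h : ∀ (x : G) (S : Set G), x ∈ Subgroup.closure S ↔ φ x ∈ Subgroup.closure (φ '' S))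
    (X : Set G) : Independent X ↔ Independent (φ '' X) := by
  simp only [Independent, Set.forall_mem_image]
  refine forall₂_congr fun x _ => ?_
  rw [h, Set.image_sdiff φ.injective, Set.image_singleton]

theorem exists_indep_iso_of_lattice_iso {G H : Type*} [Group G] [Finite G] [Group H] [Finite H]
    (α : Subgroup G ≃o Subgroup H) (hα : ∀ K, Nat.card (α K) = Nat.card K) :
    ∃ φ : G ≃ H, ∀ X : Set G, Independent X ↔ Independent (φ '' X) := by
  obtain ⟨φ, hφ⟩ := exists_equiv_comp_eq (fun x : G => α (Subgroup.zpowers x))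
    (fun y : H => Subgroup.zpowers y) (fun i => by
      have := card_generators_eq α hα (α.symm i)
      rw [OrderIso.apply_symm_apply] at this
      rw [← this]
      exact Nat.card_congr (Equiv.subtypeEquivRight fun x => by
        rw [← α.injective.eq_iff (b := α.symm i), OrderIso.apply_symm_apply]))
  have mem : ∀ x K, φ x ∈ α K ↔ x ∈ K := fun x K => by
    rw [← Subgroup.zpowers_le, hφ, α.le_iff_le, Subgroup.zpowers_le]
  have hcl : ∀ S : Set G, α (Subgroup.closure S) = Subgroup.closure (φ '' S) := fun S => by
    apply le_antisymm
    · rw [← OrderIso.le_symm_apply, Subgroup.closure_le]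
      intro s hs
      rw [SetLike.mem_coe, ← mem, OrderIso.apply_symm_apply]
      exact Subgroup.subset_closure (Set.mem_image_of_mem φ hs)
    · rw [Subgroup.closure_le]
      rintro _ ⟨s, hs, rfl⟩
      exact (mem s _).2 (Subgroup.subset_closure hs)
  exact ⟨φ, independent_image_iff φ fun x S => by rw [← mem, hcl]⟩

theorem mem_of_pow_mem_of_zpow_mem {G : Type*} [Group G] {p : ℕ} (hp : p.Prime) {K : Subgroup G}
    {w : G} (h : w ^ p ∈ K) {k : ℤ} (hk : ¬ (p : ℤ) ∣ k) (hwk : w ^ k ∈ K) : w ∈ K := by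
  obtain ⟨a, b, hab⟩ := (Nat.prime_iff_prime_int.1 hp).coprime_iff_not_dvd.2 hk
  have : w = (w ^ p) ^ a * (w ^ k) ^ b := by
    rw [← zpow_natCast, ← zpow_mul, ← zpow_mul, ← zpow_add, mul_comm (p : ℤ), mul_comm k, hab,
      zpow_one]
  rw [this]
  exact K.mul_mem (K.zpow_mem h a) (K.zpow_mem hwk b)

theorem zpow_eq_one_or_mem_of_zpow_mem {G : Type*} [Group G] {K : Subgroup G} {z : G}
    (hz : (orderOf z).Prime) {k : ℤ} (h : z ^ k ∈ K) : z ^ k = 1 ∨ z ∈ K := by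
  by_cases hk : (orderOf z : ℤ) ∣ k
  · exact Or.inl (orderOf_dvd_iff_zpow_eq_one.1 hk)
  · exact Or.inr (mem_of_pow_mem_of_zpow_mem hz (by rw [pow_orderOf_eq_one]; exact K.one_mem) hk h)

theorem exists_independent_subset_closure_eq {G : Type*} [Group G] [Finite G] (S : Set G) :
    ∃ T ⊆ S, Independent T ∧ Subgroup.closure T = Subgroup.closure S := by
  induction S using WellFoundedLT.induction with
  | _ S ih =>
  by_cases hS : Independent S
  · exact ⟨S, subset_rfl, hS, rfl⟩
  · simp only [Independent, not_forall, not_not] at hS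
    obtain ⟨x, hx, hxS⟩ := hS
    obtain ⟨T, hT, hTi, hTc⟩ := ih (S \ {x}) (Set.sdiff_singleton_ssubset.2 hx)
    refine ⟨T, hT.trans Set.sdiff_subset, hTi, hTc.trans ?_⟩
    refine le_antisymm (Subgroup.closure_mono Set.sdiff_subset) ((Subgroup.closure_le _).2 ?_)
    intro y hy
    by_cases hyx : y = x
    · exact hyx ▸ hxS
    · exact Subgroup.subset_closure ⟨hy, hyx⟩

theorem zpowers_normal_of_mem_center {G : Type*} [Group G] {z : G}
    (hz : z ∈ Subgroup.center G) : (Subgroup.zpowers z).Normal := by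
  refine ⟨fun n hn g => ?_⟩
  have := Subgroup.mem_center_iff.1 (Subgroup.zpowers_le.2 hz hn) g
  rwa [this, mul_inv_cancel_right]

theorem mem_sup_zpowers_iff {G : Type*} [Group G] {z : G} (hz : z ∈ Subgroup.center G)
    {K : Subgroup G} {x : G} :
    x ∈ K ⊔ Subgroup.zpowers z ↔ ∃ y ∈ K, ∃ k : ℤ, x = y * z ^ k := by
  have := zpowers_normal_of_mem_center hz
  rw [Subgroup.mem_sup_of_normal_right]
  simp only [Subgroup.mem_zpowers_iff, exists_exists_eq_and, @eq_comm _ x]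

/-- Membership of a central element of prime order in the subgroup generated by a set can be read
off from independence. -/
theorem mem_closure_image_of_mem_closure {G H : Type*} [Group G] [Finite G] [Group H] (φ : G ≃ H)
    (hind : ∀ X : Set G, Independent X ↔ Independent (φ '' X)) {z : G}
    (hz : φ z ∈ Subgroup.center H) (hp : (orderOf (φ z)).Prime) {S : Set G}
    (h : z ∈ Subgroup.closure S) : φ z ∈ Subgroup.closure (φ '' S) := by
  obtain ⟨T, hTS, hTi, hTc⟩ := exists_independent_subset_closure_eq S
  rw [← hTc] at h
  refine Subgroup.closure_mono (Set.image_mono hTS) ?_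
  by_cases hzT : z ∈ T
  · exact Subgroup.subset_closure (Set.mem_image_of_mem φ hzT)
  have hdep : ¬ Independent (insert z T) := fun hi =>
    hi z (Set.mem_insert _ _) (by rwa [Set.insert_sdiff_self_of_notMem hzT])
  rw [hind, Set.image_insert_eq] at hdep
  simp only [Independent, not_forall, not_not] at hdep
  have hzT' : φ z ∉ φ '' T := by rwa [φ.injective.mem_set_image]
  obtain ⟨v, hv, hvc⟩ := hdep
  rcases Set.mem_insert_iff.1 hv with rfl | hvT
  · rwa [Set.insert_sdiff_self_of_notMem hzT'] at hvc
  have hle : Subgroup.closure (insert (φ z) (φ '' T) \ {v}) ≤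
      Subgroup.closure (φ '' T \ {v}) ⊔ Subgroup.zpowers (φ z) := by
    rw [Subgroup.closure_le]
    rintro y ⟨rfl | hy, hyv⟩
    · exact Subgroup.mem_sup_right (Subgroup.mem_zpowers _)
    · exact Subgroup.mem_sup_left (Subgroup.subset_closure ⟨hy, hyv⟩)
  obtain ⟨c, hc, k, hk⟩ := (mem_sup_zpowers_iff hz).1 (hle hvc)
  have hcT := Subgroup.closure_mono Set.sdiff_subset hc
  have hmem : φ z ^ k ∈ Subgroup.closure (φ '' T) := by
    rw [eq_inv_mul_of_mul_eq hk.symm]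
    exact Subgroup.mul_mem _ (Subgroup.inv_mem _ hcT) (Subgroup.subset_closure hvT)
  refine (zpow_eq_one_or_mem_of_zpow_mem hp hmem).resolve_left fun h1 => ?_
  rw [h1, mul_one] at hk
  exact (hind T).1 hTi v hvT (hk ▸ hc)

theorem orderOf_map_eq {G H : Type*} [Group G] [Group H] (φ : G ≃ H)
    (hpow : ∀ x y, x ∈ Subgroup.zpowers y ↔ φ x ∈ Subgroup.zpowers (φ y)) (x : G) :
    orderOf (φ x) = orderOf x := by
  rw [← Nat.card_zpowers, ← Nat.card_zpowers]
  exact (Nat.card_congr (φ.subtypeEquiv fun y => hpow y x)).symm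

theorem card_sup_zpowers {G : Type*} [Group G] {z : G} (hz : z ∈ Subgroup.center G)
    (hp : (orderOf z).Prime) {K : Subgroup G} (hzK : z ∉ K) :
    Nat.card (K ⊔ Subgroup.zpowers z : Subgroup G) = Nat.card K * orderOf z := by
  have := zpowers_normal_of_mem_center hz
  have hbot : Subgroup.zpowers z ⊓ K = ⊥ := by
    rw [Subgroup.eq_bot_iff_forall]
    rintro x ⟨hx, hxK⟩
    obtain ⟨k, rfl⟩ := Subgroup.mem_zpowers_iff.1 hx
    exact (zpow_eq_one_or_mem_of_zpow_mem hp hxK).resolve_right hzK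
  have h := Subgroup.relIndex_mul_relIndex ⊥ (Subgroup.zpowers z) (K ⊔ Subgroup.zpowers z)
    bot_le le_sup_right
  rw [Subgroup.relIndex_sup_right, ← Subgroup.inf_relIndex_right (Subgroup.zpowers z) K, hbot] at h
  simp only [Subgroup.relIndex_bot_left, Nat.card_zpowers] at h
  rw [← h, mul_comm]

theorem mem_sup_of_map_eq_mul_zpow {G H : Type*} [CommGroup G] [Finite G] [Group H] [Finite H]
    (φ : G ≃ H) (hpow : ∀ x y, x ∈ Subgroup.zpowers y ↔ φ x ∈ Subgroup.zpowers (φ y))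
    (hind : ∀ X : Set G, Independent X ↔ Independent (φ '' X)) {z : G}
    (hz : φ z ∈ Subgroup.center H) (hp : (orderOf z).Prime) {x w : G} {k : ℤ}
    (hzx : z ∉ Subgroup.zpowers x) (hw : φ w = φ x * φ z ^ k) :
    w ∈ Subgroup.zpowers x ⊔ Subgroup.zpowers z := by
  have hord := orderOf_map_eq φ hpow
  have hx : Subgroup.zpowers x ≤ Subgroup.zpowers x ⊔ Subgroup.zpowers z := le_sup_left
  have hz' : ∀ n : ℤ, z ^ n ∈ Subgroup.zpowers x ⊔ Subgroup.zpowers z := fun n =>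
    Subgroup.mem_sup_right (Subgroup.zpow_mem_zpowers z n)
  by_cases hwx : w = x
  · exact hwx ▸ hx (Subgroup.mem_zpowers _)
  by_cases hwz : w = z
  · simpa [hwz] using hz' 1
  have hwp : w ^ orderOf z ∈ Subgroup.zpowers x := by
    have hcomm : Commute (φ x) (φ z ^ k) :=
      (show Commute (φ x) (φ z) from Subgroup.mem_center_iff.1 hz (φ x)).zpow_right k
    have h1 : φ w ^ orderOf z = φ x ^ orderOf z := by
      rw [hw, hcomm.mul_pow, ← zpow_natCast (φ z ^ k), zpow_comm, zpow_natCast, ← hord z,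
        pow_orderOf_eq_one, one_zpow, mul_one]
    obtain ⟨v, hv⟩ := φ.surjective (φ w ^ orderOf z)
    have hvw : v ∈ Subgroup.zpowers w := by
      rw [hpow, hv]; exact Subgroup.npow_mem_zpowers _ _
    have hvx : v ∈ Subgroup.zpowers x := by
      rw [hpow, hv, h1]; exact Subgroup.npow_mem_zpowers _ _
    have hvo : orderOf (w ^ orderOf z) = orderOf v := by
      rw [← hord v, hv, orderOf_pow, orderOf_pow, hord w]
    exact Subgroup.zpowers_le.2 hvx
      (mem_zpowers_of_orderOf_dvd (Subgroup.npow_mem_zpowers _ _) hvw hvo.dvd)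
  have hwpk : ∀ {n : ℤ}, (orderOf z : ℤ) ∣ n → w ^ n ∈ Subgroup.zpowers x := by
    rintro _ ⟨m, rfl⟩
    rw [zpow_mul, zpow_natCast]
    exact Subgroup.zpow_mem _ hwp m
  have fin : ∀ {n : ℤ}, ¬ (orderOf z : ℤ) ∣ n → w ^ n ∈ Subgroup.zpowers x ⊔ Subgroup.zpowers z →
      w ∈ Subgroup.zpowers x ⊔ Subgroup.zpowers z := fun hn h =>
    mem_of_pow_mem_of_zpow_mem hp (hx hwp) hn h
  have hdep : ¬ Independent ({x, w, z} : Set G) := by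
    rw [hind]
    intro hi
    refine hi (φ w) (by simp) ?_
    suffices h : φ x * φ z ^ k ∈ Subgroup.closure (φ '' {x, w, z} \ {φ w}) by rwa [← hw] at h
    have hmem : ∀ a ∈ ({x, w, z} : Set G), a ≠ w →
        φ a ∈ Subgroup.closure (φ '' {x, w, z} \ {φ w}) := fun a ha haw =>
      Subgroup.subset_closure ⟨Set.mem_image_of_mem φ ha, fun h => haw (φ.injective h)⟩
    exact Subgroup.mul_mem _ (hmem x (by simp) (Ne.symm hwx))
      (Subgroup.zpow_mem _ (hmem z (by simp) (Ne.symm hwz)) k)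
  simp only [Independent, not_forall, not_not] at hdep
  obtain ⟨u, hu, huc⟩ := hdep
  have hsub : ∀ {a b : G}, ({x, w, z} : Set G) \ {u} ⊆ {a, b} → ∃ m n : ℤ, a ^ m * b ^ n = u :=
    fun h => Subgroup.mem_closure_pair.1 (Subgroup.closure_mono h huc)
  rcases hu with rfl | rfl | rfl
  · obtain ⟨m, n, hmn⟩ := hsub (a := w) (b := z) (by rintro y ⟨rfl | rfl | rfl, hy⟩ <;> simp_all)
    by_cases hm : (orderOf z : ℤ) ∣ m
    · have hzn : z ^ n ∈ Subgroup.zpowers u := by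
        rw [eq_inv_mul_of_mul_eq hmn]
        exact Subgroup.mul_mem _ (Subgroup.inv_mem _ (hwpk hm)) (Subgroup.mem_zpowers u)
      have hzn1 := (zpow_eq_one_or_mem_of_zpow_mem hp hzn).resolve_right hzx
      have huw : u ∈ Subgroup.zpowers w := ⟨m, by simpa [hzn1] using hmn⟩
      have hzk : φ z ^ k ∈ Subgroup.zpowers (φ w) := by
        rw [eq_inv_mul_of_mul_eq hw.symm]
        exact Subgroup.mul_mem _ (Subgroup.inv_mem _ ((hpow _ _).1 huw)) (Subgroup.mem_zpowers _)
      rcases zpow_eq_one_or_mem_of_zpow_mem (hord z ▸ hp) hzk with h1 | h1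
      · exact absurd (φ.injective (by rw [hw, h1, mul_one])) hwx
      · obtain ⟨l, rfl⟩ := (hpow _ _).2 h1
        by_cases hl : (orderOf (w ^ l) : ℤ) ∣ l
        · exact absurd (hwpk hl) hzx
        · exact fin hl (by simpa using hz' 1)
    · refine fin hm ?_
      rw [eq_mul_inv_of_mul_eq hmn]
      exact Subgroup.mul_mem _ (hx (Subgroup.mem_zpowers u)) (Subgroup.inv_mem _ (hz' n))
  · obtain ⟨m, n, hmn⟩ := hsub (a := x) (b := z) (by rintro y ⟨rfl | rfl | rfl, hy⟩ <;> simp_all)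
    rw [← hmn]
    exact Subgroup.mul_mem _ (hx (Subgroup.zpow_mem_zpowers _ _)) (hz' n)
  · obtain ⟨m, n, hmn⟩ := hsub (a := x) (b := w) (by rintro y ⟨rfl | rfl | rfl, hy⟩ <;> simp_all)
    by_cases hn : (orderOf u : ℤ) ∣ n
    · refine absurd ?_ hzx
      rw [← hmn]
      exact Subgroup.mul_mem _ (Subgroup.zpow_mem_zpowers _ _) (hwpk hn)
    · refine fin hn ?_
      rw [eq_inv_mul_of_mul_eq hmn]
      exact Subgroup.mul_mem _ (Subgroup.inv_mem _ (hx (Subgroup.zpow_mem_zpowers _ _)))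
        (by simpa using hz' 1)

theorem mem_zpowers_sup_iff {G H : Type*} [CommGroup G] [Finite G] [Group H] [Finite H]
    (φ : G ≃ H) (hpow : ∀ x y, x ∈ Subgroup.zpowers y ↔ φ x ∈ Subgroup.zpowers (φ y))
    (hind : ∀ X : Set G, Independent X ↔ Independent (φ '' X)) {z : G}
    (hz : φ z ∈ Subgroup.center H) (hp : (orderOf z).Prime) (x w : G) :
    w ∈ Subgroup.zpowers x ⊔ Subgroup.zpowers z ↔
      φ w ∈ Subgroup.zpowers (φ x) ⊔ Subgroup.zpowers (φ z) := by
  have hord := orderOf_map_eq φ hpow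
  by_cases hzx : z ∈ Subgroup.zpowers x
  · rw [sup_of_le_left (Subgroup.zpowers_le.2 hzx),
      sup_of_le_left (Subgroup.zpowers_le.2 ((hpow _ _).1 hzx)), hpow]
  have hsub : ∀ w, φ w ∈ Subgroup.zpowers (φ x) ⊔ Subgroup.zpowers (φ z) →
      w ∈ Subgroup.zpowers x ⊔ Subgroup.zpowers z := by
    intro w hw
    obtain ⟨y', hy', k, hk⟩ := (mem_sup_zpowers_iff hz).1 hw
    obtain ⟨y, rfl⟩ := φ.surjective y'
    have hyx := Subgroup.zpowers_le.2 ((hpow _ _).2 hy')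
    exact sup_le_sup_right hyx _
      (mem_sup_of_map_eq_mul_zpow φ hpow hind hz hp (fun h => hzx (hyx h)) hk)
  refine ⟨fun hw => ?_, hsub w⟩
  have hcard : Nat.card (Subgroup.zpowers x ⊔ Subgroup.zpowers z : Subgroup G) =
      Nat.card (Subgroup.zpowers (φ x) ⊔ Subgroup.zpowers (φ z) : Subgroup H) := by
    rw [card_sup_zpowers (Subgroup.mem_center_iff.2 fun g => mul_comm g z) hp hzx,
      card_sup_zpowers hz (hord z ▸ hp) (fun h => hzx ((hpow _ _).2 h)), Nat.card_zpowers,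
      Nat.card_zpowers, hord, hord]
  have heq : (φ ⁻¹' (Subgroup.zpowers (φ x) ⊔ Subgroup.zpowers (φ z) : Subgroup H) : Set G) =
      (Subgroup.zpowers x ⊔ Subgroup.zpowers z : Subgroup G) := by
    refine Set.eq_of_subset_of_ncard_le hsub ?_
    rw [Set.ncard_preimage_of_injective_subset_range φ.injective (by simp)]
    exact hcard.le
  exact heq.ge hw

theorem mk_mem_zpowers_mk_iff {G : Type*} [Group G] (N : Subgroup G) [N.Normal] (x y : G) :
    (y : G ⧸ N) ∈ Subgroup.zpowers (x : G ⧸ N) ↔ y ∈ Subgroup.zpowers x ⊔ N := by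
  rw [sup_comm, ← QuotientGroup.comap_map_mk' N, MonoidHom.map_zpowers]
  rfl

theorem zpowers_eq_zpowers_iff {G : Type*} [Group G] {x y : G} :
    Subgroup.zpowers x = Subgroup.zpowers y ↔
      x ∈ Subgroup.zpowers y ∧ y ∈ Subgroup.zpowers x := by
  rw [le_antisymm_iff, Subgroup.zpowers_le, Subgroup.zpowers_le]

theorem exists_quotient_equiv {G H : Type*} [Group G] [Finite G] [Group H] [Finite H]
    (φ : G ≃ H) (N : Subgroup G) [N.Normal] (N' : Subgroup H) [N'.Normal]
    (hN : Nat.card N = Nat.card N')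
    (hsup : ∀ x w, w ∈ Subgroup.zpowers x ⊔ N ↔ φ w ∈ Subgroup.zpowers (φ x) ⊔ N') :
    ∃ ψ : G ⧸ N ≃ H ⧸ N', ∀ x : G,
      Subgroup.zpowers (ψ x) = Subgroup.zpowers (φ x : H ⧸ N') := by
  have hmk : ∀ x : G, Subgroup.zpowers (φ (Quotient.out (x : G ⧸ N)) : H ⧸ N') =
      Subgroup.zpowers (φ x : H ⧸ N') := by
    intro x
    rw [zpowers_eq_zpowers_iff, mk_mem_zpowers_mk_iff, mk_mem_zpowers_mk_iff, ← hsup, ← hsup,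
      ← mk_mem_zpowers_mk_iff, ← mk_mem_zpowers_mk_iff, QuotientGroup.out_eq']
    exact ⟨Subgroup.mem_zpowers _, Subgroup.mem_zpowers _⟩
  obtain ⟨ψ, hψ⟩ := exists_equiv_comp_eq
    (fun a : G ⧸ N => Subgroup.zpowers (φ (Quotient.out a) : H ⧸ N'))
    (fun b : H ⧸ N' => Subgroup.zpowers b) (fun C => by
      refine Nat.eq_of_mul_eq_mul_left (Nat.card_pos (α := N)) ?_
      nth_rewrite 2 [hN]
      rw [← Nat.card_prod, ← Nat.card_prod]
      refine Nat.card_congr ?_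
      refine (QuotientGroup.preimageMkEquivSubgroupProdSet N
        {a : G ⧸ N | Subgroup.zpowers (φ (Quotient.out a) : H ⧸ N') = C}).symm.trans
        (Equiv.trans ?_ (QuotientGroup.preimageMkEquivSubgroupProdSet N'
        {b : H ⧸ N' | Subgroup.zpowers b = C}))
      refine φ.subtypeEquiv fun x => ?_
      simp only [Set.mem_preimage, Set.mem_ofPred_eq, hmk])
  exact ⟨ψ, fun x => (hψ x).trans (hmk x)⟩

theorem independent_of_image_quotient {G H : Type*} [Group G] [Group H] (φ : G ≃ H)
    (hind : ∀ X : Set G, Independent X ↔ Independent (φ '' X))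
    (N : Subgroup G) [N.Normal] (N' : Subgroup H) [N'.Normal] (ψ : G ⧸ N ≃ H ⧸ N')
    (hψ : ∀ x : G, Subgroup.zpowers (ψ x) = Subgroup.zpowers (φ x : H ⧸ N')) {X : Set (G ⧸ N)}
    (hX : Independent (ψ '' X)) : Independent X := by
  intro x hx hxX
  set S : Set G := Quotient.out '' (X \ {x}) with hS
  have hmkS : QuotientGroup.mk' N '' S = X \ {x} := by
    rw [hS, ← Set.image_comp]
    convert Set.image_id (X \ {x}) with y
    exact QuotientGroup.out_eq' y
  rw [← hmkS, ← MonoidHom.map_closure] at hxX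
  obtain ⟨t, ht, htx⟩ := hxX
  have hmem : ∀ s ∈ S, (s : G ⧸ N) ∈ X \ {x} := fun s hs => hmkS ▸ Set.mem_image_of_mem _ hs
  have htS : t ∉ S := fun h => (hmem t h).2 htx
  have hdep : ¬ Independent (insert t S) := fun h => h t (Set.mem_insert t S) (by
    rwa [Set.insert_sdiff_self_of_notMem htS])
  rw [hind] at hdep
  simp only [Independent, not_forall, not_not] at hdep
  obtain ⟨_, ⟨u, hu, rfl⟩, huc⟩ := hdep
  have hTX : ∀ v ∈ insert t S, (v : G ⧸ N) ∈ X := by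
    rintro v (rfl | hv)
    · rwa [show (v : G ⧸ N) = x from htx]
    · exact (hmem v hv).1
  have hinj : ∀ v ∈ insert t S, ∀ w ∈ insert t S, (v : G ⧸ N) = w → v = w := by
    have hout : ∀ s ∈ S, Quotient.out (s : G ⧸ N) = s := by
      rintro _ ⟨y, -, rfl⟩
      rw [QuotientGroup.out_eq']
    rintro v (rfl | hv) w (rfl | hw) h
    · rfl
    · exact absurd (h ▸ htx) (hmem w hw).2
    · exact absurd (h ▸ htx) (hmem v hv).2
    · rw [← hout v hv, h, hout w hw]
  refine hX _ (Set.mem_image_of_mem ψ (hTX u hu)) ?_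
  have hle : Subgroup.closure (φ '' insert t S \ {φ u}) ≤
      (Subgroup.closure (ψ '' X \ {ψ u})).comap (QuotientGroup.mk' N') := by
    rw [Subgroup.closure_le]
    rintro _ ⟨⟨v, hv, rfl⟩, hvu⟩
    have hv' : ψ v ∈ Subgroup.closure (ψ '' X \ {ψ u}) :=
      Subgroup.subset_closure ⟨Set.mem_image_of_mem ψ (hTX v hv), fun h =>
        hvu (congrArg φ (hinj v hv u hu (ψ.injective h)))⟩
    exact Subgroup.zpowers_le.2 hv' ((hψ v).ge (Subgroup.mem_zpowers _))
  have huc' : (φ u : H ⧸ N') ∈ Subgroup.closure (ψ '' X \ {ψ u}) := hle huc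
  exact Subgroup.zpowers_le.2 huc' ((hψ u).le (Subgroup.mem_zpowers _))

theorem exists_subgroup_mem_iff {G H : Type*} [Group G] [Finite G] [Group H] [Finite H]
    (φ : G ≃ H) (hind : ∀ X : Set G, Independent X ↔ Independent (φ '' X)) {z : G}
    (hz : z ∈ Subgroup.center G) (hz' : φ z ∈ Subgroup.center H) (hp : (orderOf z).Prime)
    (hord : orderOf (φ z) = orderOf z)
    (h : ∀ K : Subgroup G, z ∈ K → ∃ K' : Subgroup H, ∀ x, x ∈ K ↔ φ x ∈ K') (K : Subgroup G) :
    ∃ K' : Subgroup H, ∀ x, x ∈ K ↔ φ x ∈ K' := by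
  by_cases hzK : z ∈ K
  · exact h K hzK
  have hzK1 : z ∈ K ⊔ Subgroup.zpowers z := Subgroup.mem_sup_right (Subgroup.mem_zpowers z)
  obtain ⟨L, hL⟩ := h _ hzK1
  have hle : (φ '' K : Set H) ⊆ Subgroup.closure (φ '' K) := Subgroup.subset_closure
  have hz0 : φ z ∉ Subgroup.closure (φ '' K) := fun hmem => by
    have := mem_closure_image_of_mem_closure φ.symm
      (fun X => by rw [hind, Equiv.image_symm_image]) (z := φ z) (by simpa using hz)
      (by simpa using hp) hmem
    rw [Equiv.symm_image_image, Equiv.symm_apply_apply, Subgroup.closure_eq] at this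
    exact hzK this
  have hKL : Subgroup.closure (φ '' K) ⊔ Subgroup.zpowers (φ z) ≤ L := by
    rw [sup_le_iff, Subgroup.closure_le, Subgroup.zpowers_le]
    refine ⟨?_, (hL z).1 hzK1⟩
    rintro _ ⟨x, hx, rfl⟩
    exact (hL x).1 (Subgroup.mem_sup_left hx)
  have hcard : Nat.card (Subgroup.closure (φ '' K)) * orderOf z ≤ Nat.card K * orderOf z := by
    rw [← card_sup_zpowers hz hp hzK, ← hord, ← card_sup_zpowers hz' (hord ▸ hp) hz0,
      Nat.card_congr (φ.subtypeEquiv hL)]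
    exact Subgroup.card_le_of_le hKL
  have hcard' := Nat.le_of_mul_le_mul_right hcard hp.pos
  have heq : (φ '' K : Set H) = Subgroup.closure (φ '' K) := by
    refine Set.eq_of_subset_of_ncard_le hle ?_
    rwa [Set.ncard_image_of_injective _ φ.injective]
  refine ⟨Subgroup.closure (φ '' K), fun x => ?_⟩
  rw [← SetLike.mem_coe (p := Subgroup.closure _), ← heq, φ.injective.mem_set_image]
  rfl

theorem exists_subgroup_mem_iff_of_quotient {G H : Type*} [Group G] [Group H] (φ : G ≃ H)
    (N : Subgroup G) [N.Normal] (N' : Subgroup H) [N'.Normal] (ψ : G ⧸ N ≃ H ⧸ N')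
    (hψ : ∀ x : G, Subgroup.zpowers (ψ x) = Subgroup.zpowers (φ x : H ⧸ N'))
    (h : ∀ K : Subgroup (G ⧸ N), ∃ K' : Subgroup (H ⧸ N'), ∀ x, x ∈ K ↔ ψ x ∈ K')
    (K : Subgroup G) (hK : N ≤ K) : ∃ K' : Subgroup H, ∀ x, x ∈ K ↔ φ x ∈ K' := by
  obtain ⟨L, hL⟩ := h (K.map (QuotientGroup.mk' N))
  refine ⟨L.comap (QuotientGroup.mk' N'), fun x => ?_⟩
  have h1 : x ∈ K ↔ (x : G ⧸ N) ∈ K.map (QuotientGroup.mk' N) := by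
    conv_lhs => rw [← sup_eq_right.2 hK, ← QuotientGroup.comap_map_mk']
    rfl
  rw [h1, hL, ← Subgroup.zpowers_le, hψ, Subgroup.zpowers_le]
  rfl

theorem subgroup_correspondence_of_nilpotent (n : ℕ) : ∀ (G H : Type) [CommGroup G] [Finite G]
    [Group H] [Finite H] [Group.IsNilpotent H], Nat.card G = n → ∀ φ : G ≃ H,
    (∀ x y, x ∈ Subgroup.zpowers y ↔ φ x ∈ Subgroup.zpowers (φ y)) →
    (∀ X : Set G, Independent X ↔ Independent (φ '' X)) →
    (∀ K : Subgroup G, ∃ K' : Subgroup H, ∀ x, x ∈ K ↔ φ x ∈ K') ∧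
      ∀ K' : Subgroup H, ∃ K : Subgroup G, ∀ x, x ∈ K' ↔ φ.symm x ∈ K := by
  induction n using Nat.strong_induction_on with
  | _ n ih =>
  intro G H _ _ _ _ _ hn φ hpow hind
  rcases subsingleton_or_nontrivial H with hH | hH
  · have hG : Subsingleton G := φ.subsingleton
    exact ⟨fun K => ⟨⊤, fun x => by simp [Subsingleton.elim x 1]⟩,
      fun K => ⟨⊤, fun x => by simp [Subsingleton.elim x 1]⟩⟩
  have hcen : Nontrivial (Subgroup.center H) := 
    (Subgroup.nontrivial_iff_ne_bot _).2 (Group.IsNilpotent.center_ne_bot H)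
  obtain ⟨p, hp, hpd⟩ := Nat.exists_prime_and_dvd
    (Finite.one_lt_card (α := Subgroup.center H)).ne'
  have := Fact.mk hp
  obtain ⟨⟨z', hz'⟩, hzo⟩ := exists_prime_orderOf_dvd_card' p hpd
  obtain ⟨z, rfl⟩ := φ.surjective z'
  have hord := orderOf_map_eq φ hpow z
  have hzp : orderOf z = p := by rw [← hord, ← hzo, Subgroup.orderOf_mk]
  have hp' : (orderOf z).Prime := hzp ▸ hp
  have hzc : z ∈ Subgroup.center G := Subgroup.mem_center_iff.2 fun g => mul_comm g z
  have := zpowers_normal_of_mem_center hz'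
  have hsup := mem_zpowers_sup_iff φ hpow hind hz' hp'
  obtain ⟨ψ, hψ⟩ := exists_quotient_equiv φ (Subgroup.zpowers z) (Subgroup.zpowers (φ z))
    (by rw [Nat.card_zpowers, Nat.card_zpowers, hord]) hsup
  have hψpow : ∀ x y, x ∈ Subgroup.zpowers y ↔ ψ x ∈ Subgroup.zpowers (ψ y) := by
    intro x y
    induction x using QuotientGroup.induction_on
    induction y using QuotientGroup.induction_on
    rw [mk_mem_zpowers_mk_iff, hsup, ← mk_mem_zpowers_mk_iff, hψ, ← Subgroup.zpowers_le, ← hψ,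
      Subgroup.zpowers_le]
  have hψ' : ∀ y : H, Subgroup.zpowers (ψ.symm y) =
      Subgroup.zpowers (φ.symm y : G ⧸ Subgroup.zpowers z) := by
    intro y
    have h := hψ (φ.symm y)
    rw [φ.apply_symm_apply, ← ψ.apply_symm_apply (y : H ⧸ Subgroup.zpowers (φ z)),
      zpowers_eq_zpowers_iff, ← hψpow, ← hψpow, ← zpowers_eq_zpowers_iff] at h
    exact h.symm
  have hind' : ∀ X : Set H, Independent X ↔ Independent (φ.symm '' X) := fun X => by
    rw [hind, Equiv.image_symm_image]
  have hψind : ∀ X, Independent X ↔ Independent (ψ '' X) := fun X =>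
    ⟨fun hX => independent_of_image_quotient φ.symm hind' _ _ ψ.symm hψ' (by
      rwa [Equiv.symm_image_image]), independent_of_image_quotient φ hind _ _ ψ hψ⟩
  have hlt : Nat.card (G ⧸ Subgroup.zpowers z) < n := by
    rw [← hn, Subgroup.card_eq_card_quotient_mul_card_subgroup (Subgroup.zpowers z),
      Nat.card_zpowers]
    exact lt_mul_of_one_lt_right Nat.card_pos hp'.one_lt
  obtain ⟨h1, h2⟩ := ih _ hlt _ _ rfl ψ hψpow hψind
  refine ⟨exists_subgroup_mem_iff φ hind hzc hz' hp' hord fun K hK =>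
      exists_subgroup_mem_iff_of_quotient φ _ _ ψ hψ h1 K (Subgroup.zpowers_le.2 hK),
    exists_subgroup_mem_iff φ.symm hind' hz' (by simpa using hzc) (hord ▸ hp')
      (by simpa using hord.symm) fun K hK =>
      exists_subgroup_mem_iff_of_quotient φ.symm _ _ ψ.symm hψ' h2 K (Subgroup.zpowers_le.2 hK)⟩

theorem isNilpotent_of_orderOf_eq {G H : Type*} [CommGroup G] [Finite G] [Group H] [Finite H]
    (φ : G ≃ H) (h : ∀ x, orderOf (φ x) = orderOf x) : Group.IsNilpotent H := by
  refine ((Group.isNilpotent_of_finite_tfae (G := H)).out 0 3).2 ?_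
  intro p hp P
  obtain ⟨Q⟩ : Nonempty (Sylow p G) := inferInstance
  have hQ : (Q : Set G) = {x | ∃ k, orderOf x = p ^ k} := by
    ext x
    refine ⟨fun hx => ?_, fun ⟨k, hk⟩ => ?_⟩
    · obtain ⟨k, hk⟩ := IsPGroup.iff_orderOf.1 Q.2 ⟨x, hx⟩
      exact ⟨k, by rwa [Subgroup.orderOf_mk] at hk⟩
    · obtain ⟨R, hR⟩ := (IsPGroup.of_card (p := p) (n := k)
        (by rw [Nat.card_zpowers, hk]) : IsPGroup p (Subgroup.zpowers x)).exists_le_sylow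
      have := Sylow.unique_of_normal Q inferInstance
      rw [Subsingleton.elim Q R]
      exact hR (Subgroup.mem_zpowers x)
  have hPsub : (P : Set H) ⊆ {y | ∃ k, orderOf y = p ^ k} := by
    intro x hx
    obtain ⟨k, hk⟩ := IsPGroup.iff_orderOf.1 P.2 ⟨x, hx⟩
    exact ⟨k, by rwa [Subgroup.orderOf_mk] at hk⟩
  have hP : (P : Set H) = {y | ∃ k, orderOf y = p ^ k} := by
    refine Set.eq_of_subset_of_ncard_le hPsub ?_
    have himg : {y : H | ∃ k, orderOf y = p ^ k} = φ '' Q := by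
      rw [hQ]
      ext y
      refine ⟨fun ⟨k, hk⟩ => ⟨φ.symm y, ⟨k, ?_⟩, φ.apply_symm_apply y⟩, ?_⟩
      · rw [← h, φ.apply_symm_apply, hk]
      · rintro ⟨x, ⟨k, hk⟩, rfl⟩
        exact ⟨k, by rw [h, hk]⟩
    rw [himg, Set.ncard_image_of_injective _ φ.injective]
    have h1 : Nat.card Q = Nat.card P := by
      rw [Sylow.card_eq_multiplicity, Sylow.card_eq_multiplicity, Nat.card_congr φ]
    exact h1.le
  refine ⟨fun x hx g => ?_⟩
  have hx' : x ∈ (P : Set H) := hx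
  show g * x * g⁻¹ ∈ (P : Set H)
  rw [hP] at hx' ⊢
  obtain ⟨k, hk⟩ := hx'
  exact ⟨k, by rw [← hk, ← MulAut.conj_apply, MulEquiv.orderOf_eq]⟩

theorem exists_lattice_iso_of_subgroup_correspondence {G H : Type*} [Group G] [Group H] (φ : G ≃ H)
    (h : ∀ K : Subgroup G, ∃ K' : Subgroup H, ∀ x, x ∈ K ↔ φ x ∈ K')
    (h' : ∀ K' : Subgroup H, ∃ K : Subgroup G, ∀ x, x ∈ K' ↔ φ.symm x ∈ K) :
    ∃ α : Subgroup G ≃o Subgroup H, ∀ K, Nat.card (α K) = Nat.card K := by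
  choose f hf using h
  choose g hg using h'
  refine ⟨{ toFun := f, invFun := g, left_inv := ?_, right_inv := ?_, map_rel_iff' := ?_ },
    fun K => (Nat.card_congr (φ.subtypeEquiv (hf K))).symm⟩
  · intro K
    ext x
    rw [hf K, hg (f K), φ.symm_apply_apply]
  · intro K
    ext x
    rw [hg K, hf (g K), φ.apply_symm_apply]
  · intro K L
    refine ⟨fun hKL x hx => (hf L x).2 (hKL ((hf K x).1 hx)), fun hKL x hx => ?_⟩
    rw [← φ.apply_symm_apply x] at hx ⊢
    exact (hf L _).1 (hKL ((hf K _).2 hx))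

theorem exists_lattice_iso_of_zpowers {G H : Type} [CommGroup G] [Finite G] [Group H] [Finite H]
    (φ : G ≃ H) (hpow : ∀ x y, x ∈ Subgroup.zpowers y ↔ φ x ∈ Subgroup.zpowers (φ y))
    (hind : ∀ X : Set G, Independent X ↔ Independent (φ '' X)) :
    ∃ α : Subgroup G ≃o Subgroup H, ∀ K, Nat.card (α K) = Nat.card K := by
  have := isNilpotent_of_orderOf_eq φ (orderOf_map_eq φ hpow)
  obtain ⟨h, h'⟩ := subgroup_correspondence_of_nilpotent _ G H rfl φ hpow hind
  exact exists_lattice_iso_of_subgroup_correspondence φ h h'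

/-- Two elements are adjacent in the power graph (loops included). -/
def PowerAdj {G : Type*} [Group G] (x y : G) : Prop :=
  x ∈ Subgroup.zpowers y ∨ y ∈ Subgroup.zpowers x

/-- Two elements are twins if they have the same neighbours in the power graph. -/
def PowerTwin {G : Type*} [Group G] (x y : G) : Prop :=
  ∀ z, PowerAdj z x ↔ PowerAdj z y

/-- The nontrivial elements which are twins of a given element in the power graph. -/
def twinClass {G : Type*} [Group G] (x : G) : Set G :=
  {y | y ≠ 1 ∧ PowerTwin y x}

theorem powerAdj_refl {G : Type*} [Group G] (x : G) : PowerAdj x x :=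
  Or.inl (Subgroup.mem_zpowers x)

theorem PowerAdj.symm {G : Type*} [Group G] {x y : G} (h : PowerAdj x y) : PowerAdj y x :=
  Or.symm h

theorem PowerTwin.symm {G : Type*} [Group G] {x y : G} (h : PowerTwin x y) : PowerTwin y x :=
  fun z => (h z).symm

theorem PowerTwin.trans {G : Type*} [Group G] {x y z : G} (h : PowerTwin x y)
    (h' : PowerTwin y z) : PowerTwin x z :=
  fun w => (h w).trans (h' w)

theorem PowerTwin.adj {G : Type*} [Group G] {x y : G} (h : PowerTwin x y) : PowerAdj x y :=
  (h x).1 (powerAdj_refl x)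

theorem powerTwin_of_zpowers_eq {G : Type*} [Group G] {x y : G}
    (h : Subgroup.zpowers x = Subgroup.zpowers y) : PowerTwin x y := by
  intro z
  rw [PowerAdj, PowerAdj, ← Subgroup.zpowers_le (g := x), ← Subgroup.zpowers_le (g := y), h]

theorem powerAdj_of_prime_pow {G : Type*} [Group G] [Finite G] {p k : ℕ} (hp : p.Prime) {g u v : G}
    (hg : orderOf g = p ^ k) (hu : u ∈ Subgroup.zpowers g) (hv : v ∈ Subgroup.zpowers g) :
    PowerAdj u v := by
  obtain ⟨a, -, ha⟩ := (Nat.dvd_prime_pow hp).1 (hg ▸ orderOf_dvd_of_mem_zpowers hu)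
  obtain ⟨b, -, hb⟩ := (Nat.dvd_prime_pow hp).1 (hg ▸ orderOf_dvd_of_mem_zpowers hv)
  rcases le_total a b with h | h
  · exact Or.inl (mem_zpowers_of_orderOf_dvd hu hv (by rw [ha, hb]; exact pow_dvd_pow p h))
  · exact Or.inr (mem_zpowers_of_orderOf_dvd hv hu (by rw [ha, hb]; exact pow_dvd_pow p h))

theorem independent_pair_iff {G : Type*} [Group G] {a b : G} (hab : a ≠ b) :
    Independent ({a, b} : Set G) ↔ ¬ PowerAdj a b := by
  simp only [Independent, Set.forall_mem_insert, Set.mem_singleton_iff, forall_eq, PowerAdj,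
    not_or]
  rw [Set.insert_sdiff_self_of_notMem (by simpa using hab), Set.pair_comm,
    Set.insert_sdiff_self_of_notMem (by simpa using hab.symm), ← Subgroup.zpowers_eq_closure,
    ← Subgroup.zpowers_eq_closure]

theorem powerAdj_map_iff {G H : Type*} [Group G] [Group H] (φ : G ≃ H)
    (hind : ∀ X : Set G, Independent X ↔ Independent (φ '' X)) (x y : G) :
    PowerAdj x y ↔ PowerAdj (φ x) (φ y) := by
  by_cases hxy : x = y
  · subst hxy
    exact iff_of_true (powerAdj_refl _) (powerAdj_refl _)
  · rw [← not_iff_not, ← independent_pair_iff hxy, ← independent_pair_iff (φ.injective.ne hxy), hind,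
      Set.image_pair]

theorem map_one_of_independent {G H : Type*} [Group G] [Group H] (φ : G ≃ H)
    (hind : ∀ X : Set G, Independent X ↔ Independent (φ '' X)) : φ 1 = 1 := by
  have h : ¬ Independent ({1} : Set G) := fun h => h 1 rfl (Subgroup.one_mem _)
  rw [hind, Set.image_singleton] at h
  by_contra h1
  exact h (by simpa [Independent] using h1)

theorem powerTwin_map_iff {G H : Type*} [Group G] [Group H] (φ : G ≃ H)
    (hadj : ∀ x y, PowerAdj x y ↔ PowerAdj (φ x) (φ y)) (x y : G) :
    PowerTwin x y ↔ PowerTwin (φ x) (φ y) := by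
  simp only [PowerTwin, φ.surjective.forall, hadj]

theorem ncard_twinClass_map {G H : Type*} [Group G] [Group H] (φ : G ≃ H) (h1 : φ 1 = 1)
    (hadj : ∀ x y, PowerAdj x y ↔ PowerAdj (φ x) (φ y)) (x : G) :
    (twinClass (φ x)).ncard = (twinClass x).ncard := by
  rw [← Set.ncard_image_of_injective (twinClass x) φ.injective]
  congr 1
  ext y
  obtain ⟨y, rfl⟩ := φ.surjective y
  rw [φ.injective.mem_set_image, twinClass, twinClass, Set.mem_ofPred_eq, Set.mem_ofPred_eq,
    ← powerTwin_map_iff φ hadj, ← h1, φ.injective.ne_iff]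

theorem setOf_zpowers_eq_subset_twinClass {G : Type*} [Group G] {x : G} (hx : x ≠ 1) :
    {y | Subgroup.zpowers y = Subgroup.zpowers x} ⊆ twinClass x := by
  refine fun y hy => ⟨?_, powerTwin_of_zpowers_eq hy⟩
  rintro rfl
  exact hx (by simpa using hy.symm)

theorem totient_orderOf_le_ncard_twinClass {G : Type*} [Group G] [Finite G] {x : G} (hx : x ≠ 1) :
    (orderOf x).totient ≤ (twinClass x).ncard := by
  rw [← card_zpowers_eq_zpowers]
  exact Set.ncard_le_ncard (setOf_zpowers_eq_subset_twinClass hx)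

theorem twinClass_eq {G : Type*} [Group G]
    (htwin : ∀ x y : G, x ≠ 1 → y ≠ 1 → PowerTwin x y → Subgroup.zpowers x = Subgroup.zpowers y)
    {x : G} (hx : x ≠ 1) : twinClass x = {y | Subgroup.zpowers y = Subgroup.zpowers x} :=
  (setOf_zpowers_eq_subset_twinClass hx).antisymm' fun y hy => htwin y x hy.1 hx hy.2

theorem ncard_twinClass {G : Type*} [Group G] [Finite G]
    (htwin : ∀ x y : G, x ≠ 1 → y ≠ 1 → PowerTwin x y → Subgroup.zpowers x = Subgroup.zpowers y)
    {x : G} (hx : x ≠ 1) : (twinClass x).ncard = (orderOf x).totient := by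
  rw [twinClass_eq htwin hx, ← card_zpowers_eq_zpowers]
  rfl

theorem exists_mem_zpowers_orderOf_eq {G : Type*} [Group G] [Finite G] (g : G) {d : ℕ}
    (hd : d ∣ orderOf g) : ∃ u ∈ Subgroup.zpowers g, orderOf u = d :=
  ⟨g ^ (orderOf g / d), Subgroup.npow_mem_zpowers _ _,
    orderOf_pow_orderOf_div (orderOf_pos g).ne' hd⟩

theorem orderOf_prime_pow_of_powerTwin {G : Type*} [Group G] [Finite G] {x y : G} (hx : x ≠ 1)
    (hxy : x ∈ Subgroup.zpowers y) (hyx : y ∉ Subgroup.zpowers x) (ht : PowerTwin x y) :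
    ∃ p t j : ℕ, p.Prime ∧ 0 < t ∧ t < j ∧ orderOf x = p ^ t ∧ orderOf y = p ^ j ∧
      ∀ w, PowerAdj w x → ∃ k, orderOf w = p ^ k := by
  have hdvd := orderOf_dvd_of_mem_zpowers hxy
  have hne : orderOf x ≠ orderOf y := fun h =>
    hyx ((zpowers_eq_of_mem_of_orderOf_eq hxy h).ge (Subgroup.mem_zpowers y))
  have hcomp : ∀ e, e ∣ orderOf y → e ∣ orderOf x ∨ orderOf x ∣ e := by
    intro e he
    obtain ⟨u, hu, rfl⟩ := exists_mem_zpowers_orderOf_eq y he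
    exact ((ht u).2 (Or.inl hu)).imp orderOf_dvd_of_mem_zpowers orderOf_dvd_of_mem_zpowers
  obtain ⟨c, hc⟩ := hdvd
  have hc1 : c ≠ 1 := by
    rintro rfl
    exact hne (by rw [hc, mul_one])
  obtain ⟨p, hp, d, rfl⟩ := Nat.exists_prime_and_dvd hc1
  obtain ⟨j, m, hm, hN⟩ := Nat.exists_eq_pow_mul_and_not_dvd (orderOf_pos y).ne' p hp.ne_one
  have hj : ¬ p ^ j ∣ orderOf x := by
    rintro ⟨c, hc'⟩
    refine hm ⟨c * d, Nat.eq_of_mul_eq_mul_left (pow_pos hp.pos j) ?_⟩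
    rw [← hN, hc, hc']
    ring
  obtain ⟨t, htj, htx⟩ := (Nat.dvd_prime_pow hp).1
    ((hcomp (p ^ j) (hN ▸ dvd_mul_right _ _)).resolve_left hj)
  have htj' : t < j := lt_of_le_of_ne htj fun h => hj (by rw [htx, h])
  have ht0 : 0 < t := by
    rcases Nat.eq_zero_or_pos t with rfl | h
    · exact absurd (orderOf_eq_one_iff.1 htx) hx
    · exact h
  have hm1 : m = 1 := by
    rcases hcomp m (hN ▸ dvd_mul_left _ _) with h | h
    · rw [htx] at h
      exact Nat.Coprime.eq_one_of_dvd
        (Nat.Coprime.pow_right _ ((Nat.Prime.coprime_iff_not_dvd hp).2 hm).symm) h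
    · exact absurd ((dvd_pow_self p ht0.ne').trans (htx ▸ h)) hm
  rw [hm1, mul_one] at hN
  refine ⟨p, t, j, hp, ht0, htj', htx, hN, fun w hw => ?_⟩
  rcases hw with hw | hw
  · obtain ⟨k, -, hk⟩ := (Nat.dvd_prime_pow hp).1 (htx ▸ orderOf_dvd_of_mem_zpowers hw)
    exact ⟨k, hk⟩
  obtain ⟨v, l, hl, hwo⟩ := Nat.exists_eq_pow_mul_and_not_dvd (orderOf_pos w).ne' p hp.ne_one
  have hcop : l.Coprime p := ((Nat.Prime.coprime_iff_not_dvd hp).2 hl).symm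
  have htv : p ^ t ∣ p ^ v := by
    have := orderOf_dvd_of_mem_zpowers hw
    rw [htx, hwo] at this
    exact (Nat.Coprime.pow_left t hcop.symm).dvd_of_dvd_mul_right this
  obtain ⟨c, hcw, hco⟩ := exists_mem_zpowers_orderOf_eq w (d := p ^ t * l)
    (hwo ▸ mul_dvd_mul_right htv l)
  have hxc : x ∈ Subgroup.zpowers c :=
    mem_zpowers_of_orderOf_dvd hw hcw (by rw [htx, hco]; exact dvd_mul_right _ _)
  rcases (ht c).1 (Or.inr hxc) with h | h
  · have hd := orderOf_dvd_of_mem_zpowers h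
    rw [hco, hN] at hd
    have hl1 := Nat.Coprime.eq_one_of_dvd (Nat.Coprime.pow_right j hcop)
      ((dvd_mul_left _ _).trans hd)
    exact ⟨v, by rw [hwo, hl1, mul_one]⟩
  · have hd := orderOf_dvd_of_mem_zpowers h
    rw [hco, hN] at hd
    have := (Nat.Coprime.pow_left j hcop.symm).dvd_of_dvd_mul_right hd
    exact absurd ((Nat.pow_dvd_pow_iff_le_right hp.one_lt).1 this) (not_le.2 htj')

theorem mem_zpowers_mul_of_coprime {G : Type*} [CommGroup G] {x b : G}
    (h : (orderOf x).Coprime (orderOf b)) : x ∈ Subgroup.zpowers (x * b) := by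
  have h1 : x ^ orderOf b ∈ Subgroup.zpowers (x * b) := by
    have : (x * b) ^ orderOf b = x ^ orderOf b := by
      rw [mul_pow, pow_orderOf_eq_one, mul_one]
    rw [← this]
    exact Subgroup.npow_mem_zpowers _ _
  obtain ⟨m, hm⟩ := exists_pow_eq_self_of_coprime h.symm
  have h2 := Subgroup.pow_mem _ h1 m
  rwa [hm] at h2

theorem exists_prime_ne_orderOf {G : Type*} [Group G] [Finite G] {q : ℕ} (hG : ¬ IsPGroup q G) :
    ∃ b : G, (orderOf b).Prime ∧ orderOf b ≠ q := by
  by_contra! h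
  refine hG (IsPGroup.of_card (n := (Nat.card G).primeFactorsList.length)
    (Nat.eq_prime_pow_of_unique_prime_dvd Nat.card_pos.ne' fun {d} hd hdG => ?_))
  have := Fact.mk hd
  obtain ⟨b, hb⟩ := exists_prime_orderOf_dvd_card' d hdG
  rw [← hb]
  exact h b (hb ▸ hd)

theorem exists_orderOf_eq_prime_notMem_zpowers {G : Type*} [CommGroup G] [Finite G] {p : ℕ}
    (hp : p.Prime) (hG : IsPGroup p G) (hc : ¬ IsCyclic G) (y : G) :
    ∃ e : G, orderOf e = p ∧ e ∉ Subgroup.zpowers y := by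
  have := Fact.mk hp
  obtain ⟨g, hg⟩ := Monoid.exists_orderOf_eq_exponent (G := G) Monoid.ExponentExists.of_finite
  have hex : ∃ h, h ∉ Subgroup.zpowers g := by
    by_contra! h
    exact hc ⟨g, h⟩
  obtain ⟨h, hhg, hmin⟩ := Set.exists_min_image {h | h ∉ Subgroup.zpowers g} orderOf
    (Set.toFinite _) hex
  have hdvd : ∀ u : G, u ≠ 1 → p ∣ orderOf u := by
    intro u hu
    obtain ⟨k, hk⟩ := IsPGroup.iff_orderOf.1 hG u
    rcases Nat.eq_zero_or_pos k with rfl | hk0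
    · exact absurd (orderOf_eq_one_iff.1 (by rw [hk, pow_zero])) hu
    · exact hk ▸ dvd_pow_self p hk0.ne'
  have h1 : h ≠ 1 := by
    rintro rfl
    exact hhg (Subgroup.one_mem _)
  have hlt : orderOf (h ^ p) < orderOf h := by
    rw [orderOf_pow_of_dvd hp.ne_zero (hdvd h h1)]
    exact Nat.div_lt_self (orderOf_pos h) hp.one_lt
  have hhp : h ^ p ∈ Subgroup.zpowers g := by
    by_contra hn
    exact not_le.2 hlt (hmin _ hn)
  obtain ⟨s, hs : g ^ s = h ^ p⟩ := mem_powers_iff_mem_zpowers.2 hhp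
  have hle : orderOf h ≤ orderOf g :=
    Nat.le_of_dvd (orderOf_pos g) (hg ▸ Monoid.order_dvd_exponent h)
  obtain ⟨s, rfl⟩ : p ∣ s := by
    by_contra hps
    obtain ⟨k, hk⟩ := IsPGroup.iff_orderOf.1 hG g
    have hco : (orderOf g).Coprime s := by
      rw [hk]
      exact Nat.Coprime.pow_left k ((Nat.Prime.coprime_iff_not_dvd hp).2 hps)
    rw [← hs, hco.orderOf_pow] at hlt
    exact not_le.2 hlt hle
  set e := h * (g ^ s)⁻¹ with he
  have heg : e ∉ Subgroup.zpowers g := fun hmem => hhg (by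
    rwa [he, Subgroup.mul_mem_cancel_right _
      (Subgroup.inv_mem _ (Subgroup.npow_mem_zpowers g s))] at hmem)
  have heo : orderOf e = p := by
    refine orderOf_eq_prime ?_ fun h1 => heg (h1 ▸ Subgroup.one_mem _)
    rw [he, mul_pow, inv_pow, ← pow_mul, mul_comm s, hs, mul_inv_cancel]
  by_cases hey : e ∈ Subgroup.zpowers y
  · have hg1 : g ≠ 1 := by
      rintro rfl
      rw [orderOf_one] at hle
      exact h1 (orderOf_eq_one_iff.1 (le_antisymm hle (orderOf_pos h)))
    obtain ⟨f, hf, hfo⟩ := exists_mem_zpowers_orderOf_eq g (hdvd g hg1)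
    refine ⟨f, hfo, fun hfy => heg ?_⟩
    exact Subgroup.zpowers_le.2 hf
      (mem_zpowers_of_orderOf_dvd hey hfy (by rw [heo, hfo]))
  · exact ⟨e, heo, hey⟩

theorem isPGroup_of_forall_powerAdj {G : Type*} [CommGroup G] [Finite G] {p : ℕ} (hp : p.Prime)
    {x : G} (hx : ∀ w, PowerAdj w x → ∃ k, orderOf w = p ^ k) : IsPGroup p G := by
  by_contra hG
  obtain ⟨b, hb, hbp⟩ := exists_prime_ne_orderOf hG
  obtain ⟨t, ht⟩ := hx x (powerAdj_refl x)
  have hco : (orderOf x).Coprime (orderOf b) := by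
    rw [ht]
    exact Nat.Coprime.pow_left t ((Nat.coprime_primes hp hb).2 hbp.symm)
  obtain ⟨k, hk⟩ := hx (x * b) (Or.inr (mem_zpowers_mul_of_coprime hco))
  have hd : orderOf b ∣ p ^ k := by
    rw [← hk]
    refine orderOf_dvd_of_mem_zpowers ?_
    rw [mul_comm]
    exact mem_zpowers_mul_of_coprime hco.symm
  exact hbp ((Nat.prime_dvd_prime_iff_eq hb hp).1 (hb.dvd_of_dvd_pow hd))

theorem zpowers_eq_of_powerTwin {G : Type*} [CommGroup G] [Finite G]
    (hG : ∀ p : ℕ, p.Prime → IsPGroup p G → ¬ IsCyclic G) {x y : G} (hx : x ≠ 1) (hy : y ≠ 1)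
    (ht : PowerTwin x y) : Subgroup.zpowers x = Subgroup.zpowers y := by
  wlog hxy : x ∈ Subgroup.zpowers y generalizing x y
  · exact (this hy hx ht.symm (ht.adj.resolve_left hxy)).symm
  by_contra hne
  have hyx : y ∉ Subgroup.zpowers x := fun h => hne (zpowers_eq_zpowers_iff.2 ⟨hxy, h⟩)
  obtain ⟨p, t, j, hp, ht0, htj, hxo, hyo, hnbr⟩ := orderOf_prime_pow_of_powerTwin hx hxy hyx ht
  have hpG := isPGroup_of_forall_powerAdj hp hnbr
  obtain ⟨e, he, hey⟩ := exists_orderOf_eq_prime_notMem_zpowers hp hpG (hG p hp hpG) y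
  obtain ⟨u, hu, huo⟩ := exists_mem_zpowers_orderOf_eq y (d := p ^ (t + 1))
    (hyo ▸ pow_dvd_pow p htj)
  have hup : orderOf (u ^ p) = p ^ t := by
    rw [orderOf_pow_of_dvd hp.ne_zero (huo ▸ dvd_pow_self p (Nat.succ_ne_zero t)), huo, pow_succ,
      Nat.mul_div_cancel _ hp.pos]
  have hwp : (u * e) ^ p = u ^ p := by
    rw [mul_pow, ← he, pow_orderOf_eq_one, mul_one]
  have hxw : x ∈ Subgroup.zpowers (u * e) :=
    Subgroup.zpowers_le.2 (hwp ▸ Subgroup.npow_mem_zpowers (u * e) p)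
      (mem_zpowers_of_orderOf_dvd hxy (Subgroup.pow_mem _ hu p) (by rw [hxo, hup]))
  rcases (ht _).1 (Or.inr hxw : PowerAdj (u * e) x) with h | h
  · exact hey ((Subgroup.mul_mem_cancel_left _ hu).1 h)
  · have hew : e ∈ Subgroup.zpowers (u * e) :=
      (Subgroup.mul_mem_cancel_left _ (Subgroup.zpowers_le.2 h hu)).1 (Subgroup.mem_zpowers _)
    exact hey (Subgroup.zpowers_le.2 hxy (mem_zpowers_of_orderOf_dvd hew hxw
      (by rw [he, hxo]; exact dvd_pow_self p ht0.ne')))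

/-- The elements adjacent to every neighbour of a given element in the power graph. -/
def dominatingSet {G : Type*} [Group G] (x : G) : Set G :=
  {z | ∀ w, PowerAdj w x → PowerAdj w z}

theorem ncard_dominatingSet_map {G H : Type*} [Group G] [Group H] (φ : G ≃ H)
    (hadj : ∀ x y, PowerAdj x y ↔ PowerAdj (φ x) (φ y)) (x : G) :
    (dominatingSet (φ x)).ncard = (dominatingSet x).ncard := by
  rw [← Set.ncard_image_of_injective (dominatingSet x) φ.injective]
  congr 1
  ext y
  obtain ⟨y, rfl⟩ := φ.surjective y
  rw [φ.injective.mem_set_image]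
  simp only [dominatingSet, Set.mem_ofPred_eq, φ.surjective.forall, hadj]

theorem dominatingSet_eq_zpowers {G : Type*} [Group G] [Finite G] {p : ℕ} (hp : p.Prime)
    (hG : IsPGroup p G) {x : G}
    (hmax : ∀ z, PowerTwin z x → x ∈ Subgroup.zpowers z → z ∈ Subgroup.zpowers x) :
    dominatingSet x = Subgroup.zpowers x := by
  have := Fact.mk hp
  have hcomp : ∀ {g u v : G}, u ∈ Subgroup.zpowers g → v ∈ Subgroup.zpowers g → PowerAdj u v := by
    intro g u v hu hv
    obtain ⟨k, hk⟩ := IsPGroup.iff_orderOf.1 hG g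
    exact powerAdj_of_prime_pow hp hk hu hv
  refine Set.Subset.antisymm (fun z hz => ?_) fun z hz w hw => ?_
  · rcases hz x (powerAdj_refl x) with hxz | hzx
    · refine hmax z (fun w => ⟨fun hw => ?_, hz w⟩) hxz
      rcases hw with hw | hw
      · exact hcomp hw hxz
      · exact Or.inr (Subgroup.zpowers_le.2 hw hxz)
    · exact hzx
  · rcases hw with hw | hw
    · exact hcomp hw hz
    · exact Or.inr (Subgroup.zpowers_le.2 hw hz)

theorem zpowers_eq_of_powerTwin_of_isPGroup {G H : Type*} [CommGroup G] [Finite G] [Group H]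
    [Finite H] (φ : G ≃ H) (h1 : φ 1 = 1) (hadj : ∀ x y, PowerAdj x y ↔ PowerAdj (φ x) (φ y))
    {p : ℕ} (hp : p.Prime) (hpG : IsPGroup p G)
    (htwin : ∀ x y : G, x ≠ 1 → y ≠ 1 → PowerTwin x y → Subgroup.zpowers x = Subgroup.zpowers y)
    {u v : H} (hu : u ≠ 1) (hv : v ≠ 1) (ht : PowerTwin u v) :
    Subgroup.zpowers u = Subgroup.zpowers v := by
  have := Fact.mk hp
  have hpH : IsPGroup p H := by
    obtain ⟨n, hn⟩ := IsPGroup.iff_card.1 hpG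
    exact IsPGroup.of_card (by rw [← Nat.card_congr φ, hn])
  obtain ⟨y, hy, hmax⟩ := Set.exists_max_image (twinClass u) orderOf (Set.toFinite _)
    ⟨u, hu, fun _ => Iff.rfl⟩
  obtain ⟨x, rfl⟩ := φ.surjective y
  have hx : x ≠ 1 := by
    rintro rfl
    exact hy.1 h1
  have hDG : (dominatingSet x).ncard = orderOf x := by
    rw [dominatingSet_eq_zpowers hp hpG, ← Nat.card_zpowers]
    · rfl
    · intro z hz hxz
      have hz1 : z ≠ 1 := by
        rintro rfl
        exact hx (by simpa using hxz)
      exact (htwin z x hz1 hx hz).le (Subgroup.mem_zpowers z)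
  have hDH : (dominatingSet (φ x)).ncard = orderOf (φ x) := by
    rw [dominatingSet_eq_zpowers hp hpH, ← Nat.card_zpowers]
    · rfl
    · intro z hz hxz
      have hz1 : z ≠ 1 := by
        rintro rfl
        exact hy.1 (by simpa using hxz)
      have hle := hmax z ⟨hz1, hz.trans hy.2⟩
      have hdvd := orderOf_dvd_of_mem_zpowers hxz
      exact (zpowers_eq_of_mem_of_orderOf_eq hxz
        (le_antisymm (Nat.le_of_dvd (orderOf_pos z) hdvd) hle)).ge (Subgroup.mem_zpowers z)
  have hord : orderOf (φ x) = orderOf x := by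
    rw [← hDH, ncard_dominatingSet_map φ hadj, hDG]
  have hT : {z | Subgroup.zpowers z = Subgroup.zpowers (φ x)} = twinClass (φ x) := by
    refine Set.eq_of_subset_of_ncard_le (setOf_zpowers_eq_subset_twinClass hy.1) ?_
    rw [ncard_twinClass_map φ h1 hadj, ncard_twinClass htwin hx, ← hord, ← card_zpowers_eq_zpowers]
    rfl
  have hmem : ∀ w, w ≠ 1 → PowerTwin w u → Subgroup.zpowers w = Subgroup.zpowers (φ x) :=
    fun w hw hwu => hT.ge ⟨hw, hwu.trans hy.2.symm⟩
  rw [hmem u hu fun _ => Iff.rfl, hmem v hv ht.symm]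

theorem zpowers_eq_of_powerTwin_of_not_isPGroup {G H : Type*} [CommGroup G] [Finite G] [Group H]
    [Finite H] (φ : G ≃ H) (h1 : φ 1 = 1) (hadj : ∀ x y, PowerAdj x y ↔ PowerAdj (φ x) (φ y))
    (hG : ∀ p : ℕ, p.Prime → ¬ IsPGroup p G)
    (htwin : ∀ x y : G, x ≠ 1 → y ≠ 1 → PowerTwin x y → Subgroup.zpowers x = Subgroup.zpowers y)
    {u v : H} (hu : u ≠ 1) (hv : v ≠ 1) (ht : PowerTwin u v) :
    Subgroup.zpowers u = Subgroup.zpowers v := by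
  wlog huv : u ∈ Subgroup.zpowers v generalizing u v
  · exact (this hv hu ht.symm (ht.adj.resolve_left huv)).symm
  by_contra hne
  have hvu : v ∉ Subgroup.zpowers u := fun h => hne (zpowers_eq_zpowers_iff.2 ⟨huv, h⟩)
  obtain ⟨p, t, j, hp, ht0, htj, huo, hvo, hnbr⟩ := orderOf_prime_pow_of_powerTwin hu huv hvu ht
  obtain ⟨x, rfl⟩ := φ.surjective u
  have hmap1 : ∀ {g : G}, g ≠ 1 → φ g ≠ 1 := fun hg h => hg (φ.injective (h.trans h1.symm))
  have hx : x ≠ 1 := by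
    rintro rfl
    exact hu h1
  have hTcard : ∀ {g : G}, g ≠ 1 → (twinClass (φ g)).ncard = (orderOf g).totient := fun hg => by
    rw [ncard_twinClass_map φ h1 hadj, ncard_twinClass htwin hg]
  have hcomp : ∀ {g a b : H}, PowerAdj g (φ x) → a ∈ Subgroup.zpowers g →
      b ∈ Subgroup.zpowers g → PowerAdj a b := by
    intro g a b hg ha hb
    obtain ⟨k, hk⟩ := hnbr g hg
    exact powerAdj_of_prime_pow hp hk ha hb
  by_cases hx2 : ∃ q r : ℕ, q.Prime ∧ r.Prime ∧ q ≠ r ∧ q ∣ orderOf x ∧ r ∣ orderOf x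
  · obtain ⟨q, r, hq, hr, hqr, hqx, hrx⟩ := hx2
    obtain ⟨a, hax, rfl⟩ := exists_mem_zpowers_orderOf_eq x hqx
    obtain ⟨b, hbx, rfl⟩ := exists_mem_zpowers_orderOf_eq x hrx
    have hab : ¬ PowerAdj (φ a) (φ b) := by
      rw [← hadj]
      rintro (h | h)
      · exact hqr ((Nat.prime_dvd_prime_iff_eq hq hr).1 (orderOf_dvd_of_mem_zpowers h))
      · exact hqr ((Nat.prime_dvd_prime_iff_eq hr hq).1 (orderOf_dvd_of_mem_zpowers h)).symm
    have hax' : PowerAdj (φ a) (φ x) := (hadj _ _).1 (Or.inl hax)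
    have hbx' : PowerAdj (φ b) (φ x) := (hadj _ _).1 (Or.inl hbx)
    have ha1 : a ≠ 1 := by
      rintro rfl
      exact hq.ne_one orderOf_one
    have hnot : ∀ w ∈ twinClass (φ x), φ a ∉ Subgroup.zpowers w := by
      intro w hw haw
      rcases (hw.2 _).2 hbx' with h | h
      · exact hab (hcomp hw.2.adj haw h)
      · exact hab (Or.inl (Subgroup.zpowers_le.2 h haw))
    obtain ⟨m, hm⟩ := hnbr _ hax'
    have hm0 : m ≠ 0 := by
      rintro rfl
      exact hmap1 ha1 (orderOf_eq_one_iff.1 (by rw [hm, pow_zero]))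
    have hsub : twinClass (φ x) ⊆ (Subgroup.zpowers (φ a) : Set H) \
        {y | Subgroup.zpowers y = Subgroup.zpowers (φ a)} := fun w hw =>
      ⟨((hw.2 _).2 hax').resolve_left (hnot w hw), fun h =>
        hnot w hw (h.ge (Subgroup.mem_zpowers _))⟩
    have hsub' : insert 1 (twinClass (φ x)) ⊆ (Subgroup.zpowers (φ a) : Set H) \
        {y | Subgroup.zpowers y = Subgroup.zpowers (φ a)} := by
      refine Set.insert_subset ⟨Subgroup.one_mem _, fun h => hmap1 ha1 ?_⟩ hsub
      simpa using (h : Subgroup.zpowers (1 : H) = Subgroup.zpowers (φ a)).symm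
    have hc := Set.ncard_le_ncard hsub'
    have hgen : {y | Subgroup.zpowers y = Subgroup.zpowers (φ a)}.ncard = (p ^ m).totient := by
      rw [← hm, ← card_zpowers_eq_zpowers]
      rfl
    have hz : (Subgroup.zpowers (φ a) : Set H).ncard = p ^ m := by
      rw [← hm, ← Nat.card_zpowers]
      rfl
    have hgsub : {y | Subgroup.zpowers y = Subgroup.zpowers (φ a)} ⊆
        (Subgroup.zpowers (φ a) : Set H) := fun y hy => hy.le (Subgroup.mem_zpowers y)
    rw [Set.ncard_insert_of_notMem fun h => h.1 rfl, Set.ncard_sdiff hgsub, hgen, hz,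
      hTcard hx] at hc
    have h2 := totient_orderOf_le_ncard_twinClass (hmap1 ha1)
    rw [hTcard ha1, hm] at h2
    have h3 : (orderOf a).totient ≤ (orderOf x).totient :=
      Nat.le_of_dvd (Nat.totient_pos.2 (orderOf_pos x)) (Nat.totient_dvd_of_dvd hqx)
    have h4 : p ^ m ≤ 2 * (p ^ m).totient := by
      obtain ⟨m, rfl⟩ := Nat.exists_eq_succ_of_ne_zero hm0
      have hp2 := hp.two_le
      rw [Nat.totient_prime_pow_succ hp, pow_succ]
      have : p ≤ 2 * (p - 1) := by omega
      calc p ^ m * p ≤ p ^ m * (2 * (p - 1)) := Nat.mul_le_mul_left _ this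
        _ = 2 * (p ^ m * (p - 1)) := by ring
    omega
  · push Not at hx2
    obtain ⟨q, hq, hqx⟩ := Nat.exists_prime_and_dvd (mt orderOf_eq_one_iff.1 hx)
    have hxo := Nat.eq_prime_pow_of_unique_prime_dvd (orderOf_pos x).ne' fun {d} hd hdx => by
      by_contra hdq
      exact hx2 d q hd hq hdq hdx hqx
    obtain ⟨b, hb, hbq⟩ := exists_prime_ne_orderOf (hG q hq)
    have hco : (orderOf x).Coprime (orderOf b) := by
      rw [hxo]
      exact Nat.Coprime.pow_left _ ((Nat.coprime_primes hq hb).2 hbq.symm)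
    have hxc := mem_zpowers_mul_of_coprime hco
    have hbc : b ∈ Subgroup.zpowers (x * b) := by
      rw [mul_comm]
      exact mem_zpowers_mul_of_coprime hco.symm
    have hbx : ¬ PowerAdj (φ b) (φ x) := by
      rw [← hadj]
      rintro (h | h)
      · exact hb.ne_one (Nat.Coprime.eq_one_of_dvd hco.symm (orderOf_dvd_of_mem_zpowers h))
      · exact hx (orderOf_eq_one_iff.1
          (Nat.Coprime.eq_one_of_dvd hco (orderOf_dvd_of_mem_zpowers h)))
    have hc1 : x * b ≠ 1 := by
      intro h
      rw [h] at hxc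
      exact hx (by simpa using hxc)
    have hsub : insert 1 (twinClass (φ (x * b))) ⊆ (Subgroup.zpowers (φ x) : Set H) := by
      refine Set.insert_subset (Subgroup.one_mem _) ?_
      rintro d ⟨-, hd⟩
      have hdx : PowerAdj d (φ x) := ((hd _).2 ((hadj _ _).1 (Or.inl hxc))).symm
      have hdb : PowerAdj (φ b) d := (hd _).2 ((hadj _ _).1 (Or.inl hbc))
      refine hdx.resolve_right fun hxd => hbx ?_
      rcases hdb with h | h
      · exact hcomp hdx h hxd
      · exact Or.inr (Subgroup.zpowers_le.2 h hxd)
    have hc := Set.ncard_le_ncard hsub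
    have hz : (Subgroup.zpowers (φ x) : Set H).ncard = p ^ t := by
      rw [← huo, ← Nat.card_zpowers]
      rfl
    rw [Set.ncard_insert_of_notMem fun h => h.1 rfl, hz, hTcard hc1] at hc
    have h2 : (p ^ j).totient ≤ (orderOf x).totient := by
      rw [← hTcard hx, ← hvo]
      refine (totient_orderOf_le_ncard_twinClass hv).trans_eq ?_
      congr 1
      ext w
      exact ⟨fun hw => ⟨hw.1, hw.2.trans ht.symm⟩, fun hw => ⟨hw.1, hw.2.trans ht⟩⟩
    have h3 : (orderOf x).totient ≤ (orderOf (x * b)).totient :=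
      Nat.le_of_dvd (Nat.totient_pos.2 (orderOf_pos _))
        (Nat.totient_dvd_of_dvd (orderOf_dvd_of_mem_zpowers hxc))
    have h4 : p ^ t ≤ (p ^ j).totient := by
      rw [Nat.totient_prime_pow hp (ht0.trans htj)]
      exact (Nat.pow_le_pow_right hp.pos (by omega)).trans
        (Nat.le_mul_of_pos_right _ (Nat.sub_pos_of_lt hp.one_lt))
    omega

theorem map_mem_zpowers_of_twins {G H : Type*} [Group G] [Finite G] [Group H] [Finite H]
    (φ : G ≃ H) (h1 : φ 1 = 1) (hadj : ∀ x y, PowerAdj x y ↔ PowerAdj (φ x) (φ y))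
    (hG : ∀ x y : G, x ≠ 1 → y ≠ 1 → PowerTwin x y → Subgroup.zpowers x = Subgroup.zpowers y)
    (hH : ∀ x y : H, x ≠ 1 → y ≠ 1 → PowerTwin x y → Subgroup.zpowers x = Subgroup.zpowers y)
    {x y : G} (hxy : x ∈ Subgroup.zpowers y) : φ x ∈ Subgroup.zpowers (φ y) := by
  by_cases hx : x = 1
  · rw [hx, h1]
    exact Subgroup.one_mem _
  have hy : y ≠ 1 := by
    rintro rfl
    exact hx (by simpa using hxy)
  have hmap1 : ∀ {g : G}, g ≠ 1 → φ g ≠ 1 := fun hg h => hg (φ.injective (h.trans h1.symm))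
  by_cases hyx : y ∈ Subgroup.zpowers x
  · have ht := (powerTwin_map_iff φ hadj x y).1
      (powerTwin_of_zpowers_eq (zpowers_eq_zpowers_iff.2 ⟨hxy, hyx⟩))
    exact (hH _ _ (hmap1 hx) (hmap1 hy) ht).le (Subgroup.mem_zpowers _)
  by_contra hxy'
  have hyx' : φ y ∈ Subgroup.zpowers (φ x) := ((hadj x y).1 (Or.inl hxy)).resolve_left hxy'
  have htot : ∀ {g : G}, g ≠ 1 → (orderOf (φ g)).totient = (orderOf g).totient := fun hg => by
    rw [← ncard_twinClass hG hg, ← ncard_twinClass hH (hmap1 hg), ncard_twinClass_map φ h1 hadj]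
  have hd := orderOf_dvd_of_mem_zpowers hxy
  have hd' := orderOf_dvd_of_mem_zpowers hyx'
  have heq : (orderOf x).totient = (orderOf y).totient := by
    refine Nat.dvd_antisymm (Nat.totient_dvd_of_dvd hd) ?_
    rw [← htot hx, ← htot hy]
    exact Nat.totient_dvd_of_dvd hd'
  have hodd : ∀ {a b : ℕ}, 0 < a → a.totient = b.totient → 2 * a = b → ¬ 2 ∣ a := by
    rintro a _ ha hab rfl h2
    rw [Nat.totient_two_mul_of_even (even_iff_two_dvd.2 h2)] at hab
    have := Nat.totient_pos.2 ha
    omega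
  have hy2 : 2 * orderOf x = orderOf y :=
    (Nat.eq_or_eq_of_totient_eq_totient hd heq).resolve_left fun h =>
      hyx ((zpowers_eq_of_mem_of_orderOf_eq hxy h).ge (Subgroup.mem_zpowers _))
  have heq' : (orderOf (φ y)).totient = (orderOf (φ x)).totient := by
    rw [htot hx, htot hy, heq]
  have hx2 : 2 * orderOf (φ y) = orderOf (φ x) :=
    (Nat.eq_or_eq_of_totient_eq_totient hd' heq').resolve_left fun h =>
      hxy' ((zpowers_eq_of_mem_of_orderOf_eq hyx' h).ge (Subgroup.mem_zpowers _))
  have hxodd := hodd (orderOf_pos x) heq hy2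
  have hyodd := hodd (orderOf_pos (φ y)) heq' hx2
  obtain ⟨s, hsy, hs⟩ := exists_mem_zpowers_orderOf_eq y (hy2 ▸ dvd_mul_right 2 _)
  have hs1 : s ≠ 1 := by
    rintro rfl
    rw [orderOf_one] at hs
    omega
  have hdvd2 : ∀ {n : ℕ}, n ∣ 2 → ¬ 2 ∣ n → n = 1 := fun hn h2 =>
    ((Nat.dvd_prime Nat.prime_two).1 hn).resolve_right fun h => h2 h.symm.dvd
  have hsx : ¬ PowerAdj s x := by
    rintro (h | h)
    · exact hxodd (hs ▸ orderOf_dvd_of_mem_zpowers h)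
    · exact hx (orderOf_eq_one_iff.1 (hdvd2 (hs ▸ orderOf_dvd_of_mem_zpowers h) hxodd))
  have hs' : orderOf (φ s) = 2 := by
    have h := htot hs1
    rw [hs, Nat.totient_two, Nat.totient_eq_one_iff] at h
    exact h.resolve_left (mt orderOf_eq_one_iff.1 (hmap1 hs1))
  rcases (hadj s y).1 (Or.inl hsy) with h | h
  · exact hsx ((hadj _ _).2 (Or.inl (Subgroup.zpowers_le.2 hyx' h)))
  · exact hmap1 hy (orderOf_eq_one_iff.1 (hdvd2 (hs' ▸ orderOf_dvd_of_mem_zpowers h) hyodd))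

theorem isCyclic_of_forall_powerAdj {G : Type*} [Group G] [Finite G]
    (h : ∀ x y : G, PowerAdj x y) : IsCyclic G := by
  obtain ⟨y, hy⟩ := Finite.exists_max (orderOf (G := G))
  refine ⟨y, fun x => (h x y).elim id fun hyx => ?_⟩
  exact (zpowers_eq_of_mem_of_orderOf_eq hyx (le_antisymm
    (Nat.le_of_dvd (orderOf_pos x) (orderOf_dvd_of_mem_zpowers hyx)) (hy x))).ge
    (Subgroup.mem_zpowers x)

theorem exists_lattice_iso_of_isCyclic {G H : Type*} [CommGroup G] [Finite G] [Group H] [Finite H]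
    (φ : G ≃ H) (hadj : ∀ x y, PowerAdj x y ↔ PowerAdj (φ x) (φ y)) {p : ℕ} (hp : p.Prime)
    (hG : IsPGroup p G) (hc : IsCyclic G) :
    ∃ α : Subgroup G ≃o Subgroup H, ∀ K, Nat.card (α K) = Nat.card K := by
  have := Fact.mk hp
  obtain ⟨g, hg⟩ := hc
  obtain ⟨k, hk⟩ := IsPGroup.iff_orderOf.1 hG g
  have hcH : IsCyclic H := isCyclic_of_forall_powerAdj fun x y => by
    rw [← φ.apply_symm_apply x, ← φ.apply_symm_apply y, ← hadj]
    exact powerAdj_of_prime_pow hp hk (hg _) (hg _)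
  have hcG : IsCyclic G := ⟨g, hg⟩
  let e := mulEquivOfCyclicCardEq (Nat.card_congr φ)
  exact ⟨e.mapSubgroup, fun K =>
    (Nat.card_congr (Subgroup.equivMapOfInjective K e.toMonoidHom e.injective).toEquiv).symm⟩

theorem exists_lattice_iso_of_independent {G H : Type} [CommGroup G] [Finite G] [Group H] [Finite H]
    (φ : G ≃ H) (hind : ∀ X : Set G, Independent X ↔ Independent (φ '' X)) :
    ∃ α : Subgroup G ≃o Subgroup H, ∀ K, Nat.card (α K) = Nat.card K := by
  have hadj := powerAdj_map_iff φ hind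
  have h1 := map_one_of_independent φ hind
  by_cases hcyc : ∃ p : ℕ, p.Prime ∧ IsPGroup p G ∧ IsCyclic G
  · obtain ⟨p, hp, hG, hc⟩ := hcyc
    exact exists_lattice_iso_of_isCyclic φ hadj hp hG hc
  push Not at hcyc
  have hGt : ∀ x y : G, x ≠ 1 → y ≠ 1 → PowerTwin x y →
      Subgroup.zpowers x = Subgroup.zpowers y := fun x y hx hy =>
    zpowers_eq_of_powerTwin hcyc hx hy
  have hHt : ∀ x y : H, x ≠ 1 → y ≠ 1 → PowerTwin x y →
      Subgroup.zpowers x = Subgroup.zpowers y := fun x y hx hy ht => by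
    by_cases hpG : ∃ p : ℕ, p.Prime ∧ IsPGroup p G
    · obtain ⟨p, hp, hpG⟩ := hpG
      exact zpowers_eq_of_powerTwin_of_isPGroup φ h1 hadj hp hpG hGt hx hy ht
    · push Not at hpG
      exact zpowers_eq_of_powerTwin_of_not_isPGroup φ h1 hadj hpG hGt hx hy ht
  refine exists_lattice_iso_of_zpowers φ (fun x y => ⟨map_mem_zpowers_of_twins φ h1 hadj hGt hHt,
    fun h => ?_⟩) hind
  simpa using map_mem_zpowers_of_twins φ.symm (φ.symm_apply_eq.2 h1.symm)
    (fun x y => by simp [hadj]) hHt hGt h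

theorem abelian_indep_iso_iff_index_preserving_lattice_iso
    (G₁ G₂ : Type) [CommGroup G₁] [Finite G₁] [Group G₂] [Finite G₂] :
    (∃ φ : G₁ ≃ G₂, ∀ X : Set G₁, Independent X ↔ Independent (φ '' X)) ↔
      (∃ α : Subgroup G₁ ≃o Subgroup G₂, ∀ H : Subgroup G₁, Nat.card (α H) = Nat.card H) :=
  ⟨fun ⟨φ, hind⟩ => exists_lattice_iso_of_independent φ hind,
    fun ⟨α, hα⟩ => exists_indep_iso_of_lattice_iso α hα⟩
end

section
/- Let G be a finite group. Then every independent subset of G is strongly independent if and only if G is monotone and has the basis property. -/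
theorem independent_iff_closure_ne {G : Type*} [Group G] (X : Set G) :
    Independent X ↔ ∀ T : Set G, T ⊂ X → Subgroup.closure T ≠ Subgroup.closure X := by
  constructor
  · intro hX T hT hcl
    obtain ⟨x, hx, hxT⟩ := Set.exists_of_ssubset hT
    refine hX x hx (Subgroup.closure_mono (Set.subset_sdiff_singleton hT.subset hxT) ?_)
    rw [hcl]
    exact Subgroup.subset_closure hx
  · intro h x hx hmem
    refine h (X \ {x}) (Set.sdiff_singleton_ssubset.2 hx) (le_antisymm
      (Subgroup.closure_mono Set.sdiff_subset) ((Subgroup.closure_le _).2 fun y hy => ?_))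
    by_cases hyx : y = x
    · exact hyx ▸ hmem
    · exact Subgroup.subset_closure ⟨hy, hyx⟩

theorem dgen_closure_le_ncard {G : Type*} [Group G] [Finite G] (S : Set G) :
    dgen (Subgroup.closure S) ≤ S.ncard :=
  Nat.sInf_le ⟨S, S.toFinite, Subgroup.subset_closure, rfl, rfl⟩

theorem exists_independent_closure_eq_ncard_eq_dgen {G : Type*} [Group G] [Finite G]
    (H : Subgroup G) :
    ∃ S : Set G, Independent S ∧ Subgroup.closure S = H ∧ S.ncard = dgen H := by
  obtain ⟨S, -, -, rfl, hcard⟩ : dgen H ∈ {n : ℕ | ∃ S : Set G, S.Finite ∧ S ⊆ (H : Set G) ∧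
      Subgroup.closure S = H ∧ S.ncard = n} :=
    Nat.sInf_mem ⟨_, H, Set.toFinite _, subset_rfl, H.closure_eq, rfl⟩
  refine ⟨S, (independent_iff_closure_ne S).2 fun T hT hcl => ?_, rfl, hcard⟩
  have hle := dgen_closure_le_ncard T
  rw [hcl, ← hcard] at hle
  exact hle.not_gt (Set.ncard_lt_ncard hT)

theorem indep_eq_strong_indep_iff_monotone_and_basis_property
    (G : Type) [Group G] [Finite G] :
    (∀ X : Set G, Independent X → StronglyIndependent X) ↔
      ((∀ H K : Subgroup G, H ≤ K → dgen H ≤ dgen K) ∧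
       (∀ H : Subgroup G, ∀ S : Set G, S ⊆ (H : Set G) → Subgroup.closure S = H →
          (∀ T : Set G, T ⊂ S → Subgroup.closure T ≠ H) → S.ncard = dgen H)) := by
  constructor
  · intro h
    refine ⟨fun H K hHK => ?_, ?_⟩
    · obtain ⟨S, hS, rfl, hcard⟩ := exists_independent_closure_eq_ncard_eq_dgen H
      exact hcard ▸ h S hS K ((Subgroup.closure_le K).1 hHK)
    · rintro _ S hSH rfl hmin
      exact le_antisymm (h S ((independent_iff_closure_ne S).2 hmin) _ hSH)
        (dgen_closure_le_ncard S)
  · rintro ⟨hmono, hbasis⟩ X hX H hXH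
    rw [hbasis _ X Subgroup.subset_closure rfl ((independent_iff_closure_ne X).1 hX)]
    exact hmono _ _ ((Subgroup.closure_le H).2 hXH)
end
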